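/- arXiv:2402.18170 — 4 statements merged into one kernel-verified Lean document; each statement's English description precedes it below -/
import Mathlib

section
/- Let C be a category and W a rigid wide subgroupoid of C. Define a relation on objects by x ∼ y iff some morphism of W goes from x to y (by rigidity such a morphism is unique, written w_{x,y}), and a relation on morphisms by f ∼ f' (for f : x ⟶ y, f' : x' ⟶ y') iff there exist v : x ⟶ x' and w : y ⟶ y' in W with f ≫ w = v ≫ f'. Then: (1) these are equivalence relations and the data with objects the ∼-classes [x] of objects, morphisms [x] ⟶ [y] the ∼-classes [f] of morphisms f : x' ⟶ y' with x' ∼ x and y' ∼ y, composition [g] ∘ [f] = [f ≫ w_{y,y'} ≫ g] (for f : x ⟶ y, g : y' ⟶ z with y ∼ y'), and identities [𝟙 x], forms a well-defined category C/∼_W; (2) the canonical functor [-] : C ⥤ C/∼_W is W-strict; and (3) every W-strict functor F : C ⥤ D factors as F = [-] ⋙ F' for a unique functor F' : C/∼_W ⥤ D. -/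
open CategoryTheory

universe w v' v u' u

/-- A wide subgroupoid of a category `C`: a family of morphisms of `C`, all of which are
isomorphisms, containing all identities and closed under composition and inverses. -/
structure WideSubgroupoid (C : Type u) [Category.{v} C] where
  /-- membership of a morphism in the wide subgroupoid -/
  mem : ∀ ⦃x y : C⦄, (x ⟶ y) → Prop
  id_mem : ∀ x : C, mem (𝟙 x)
  comp_mem : ∀ ⦃x y z : C⦄ ⦃f : x ⟶ y⦄ ⦃g : y ⟶ z⦄, mem f → mem g → mem (f ≫ g)
  is_iso : ∀ ⦃x y : C⦄ ⦃f : x ⟶ y⦄, mem f → IsIso f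
  inv_mem : ∀ ⦃x y : C⦄ ⦃f : x ⟶ y⦄ ⦃g : y ⟶ x⦄, mem f → f ≫ g = 𝟙 x → mem g

variable {C : Type u} [Category.{v} C]

/-- A wide subgroupoid is rigid when any two parallel morphisms belonging to it are equal. -/
def WideSubgroupoid.Rigid (W : WideSubgroupoid C) : Prop :=
  ∀ ⦃x y : C⦄ ⦃f g : x ⟶ y⦄, W.mem f → W.mem g → f = g

/-- A functor is `W`-strict when it sends every morphism of `W` to an identity morphism
(in particular it sends the source and the target of such a morphism to the same object). -/
def WideSubgroupoid.IsStrict (W : WideSubgroupoid C) {D : Type u'} [Category.{v'} D]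
    (F : C ⥤ D) : Prop :=
  ∀ ⦃x y : C⦄ ⦃f : x ⟶ y⦄, W.mem f → ∃ h : F.obj x = F.obj y, F.map f = eqToHom h

/-- The relation on objects of `C` identifying `x` and `y` whenever some morphism of `W`
goes from `x` to `y`. -/
def WideSubgroupoid.ObjRel (W : WideSubgroupoid C) (x y : C) : Prop :=
  ∃ f : x ⟶ y, W.mem f

/-- The type of all morphisms of `C`. -/
def Mor (C : Type u) [Category.{v} C] : Type max u v :=
  Σ x : C, Σ y : C, x ⟶ y

/-- The relation on morphisms of `C` identifying `f : x ⟶ y` and `f' : x' ⟶ y'` whenever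
there are `v : x ⟶ x'` and `w : y ⟶ y'` in `W` with `f ≫ w = v ≫ f'`. -/
def WideSubgroupoid.MorRel (W : WideSubgroupoid C) (m m' : Mor C) : Prop :=
  ∃ (v : m.1 ⟶ m'.1) (w : m.2.1 ⟶ m'.2.1), W.mem v ∧ W.mem w ∧ m.2.2 ≫ w = v ≫ m'.2.2

/-- The data exhibiting the explicit quotient category `C/∼_W` of a category `C` by a rigid
wide subgroupoid `W`: a category structure on the type of equivalence classes of objects,
together with the canonical functor `π` sending an object to its class, such that morphisms
`[x] ⟶ [y]` are exactly the equivalence classes of morphisms of `C` (fields `full` and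
`hom_eq_iff`), composition is given by `[g] ∘ [f] = [f ≫ w_{y,y'} ≫ g]` (field `comp_eq`),
the functor `π` is `W`-strict, and every `W`-strict functor out of `C` factors uniquely
through `π`. -/
structure WideSubgroupoid.ExplicitQuotient (W : WideSubgroupoid C) where
  [instCat : Category.{max u v} (Quot W.ObjRel)]
  /-- the canonical quotient functor -/
  π : C ⥤ Quot W.ObjRel
  /-- on objects, `π` is the canonical quotient map onto equivalence classes -/
  obj_eq : ∀ x : C, π.obj x = Quot.mk W.ObjRel x
  /-- two objects have the same class iff they are related -/
  obj_eq_iff : ∀ x y : C, π.obj x = π.obj y ↔ W.ObjRel x y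
  /-- every morphism between classes is the class of a morphism of `C` -/
  full : ∀ ⦃x y : C⦄ (g : π.obj x ⟶ π.obj y), ∃ f : x ⟶ y, π.map f = g
  /-- two morphisms of `C` have the same class (modulo the identification of their
  endpoints) iff they are related by `∼_W` -/
  hom_eq_iff : ∀ ⦃x y x' y' : C⦄ (f : x ⟶ y) (f' : x' ⟶ y')
      (hx : π.obj x = π.obj x') (hy : π.obj y = π.obj y'),
      (π.map f ≫ eqToHom hy = eqToHom hx ≫ π.map f') ↔ W.MorRel ⟨x, y, f⟩ ⟨x', y', f'⟩
  /-- composition in the quotient is computed by `[g] ∘ [f] = [f ≫ w_{y,y'} ≫ g]` -/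
  comp_eq : ∀ ⦃x y y' z : C⦄ (f : x ⟶ y) (w : y ⟶ y') (g : y' ⟶ z), W.mem w →
      ∀ h : π.obj y = π.obj y',
      π.map (f ≫ w ≫ g) = π.map f ≫ eqToHom h ≫ π.map g
  /-- the canonical functor is `W`-strict -/
  strict : W.IsStrict π
  /-- every `W`-strict functor factors uniquely through `π` -/
  universal : ∀ {D : Type max u v} [Category.{max u v} D] (F : C ⥤ D),
      W.IsStrict F → ∃! F' : Quot W.ObjRel ⥤ D, π ⋙ F' = F

namespace WideSubgroupoid

theorem objRel_equiv (W : WideSubgroupoid C) : Equivalence W.ObjRel where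
  refl x := ⟨𝟙 x, W.id_mem x⟩
  symm := by
    rintro x y ⟨f, hf⟩
    have := W.is_iso hf
    exact ⟨inv f, W.inv_mem hf (IsIso.hom_inv_id f)⟩
  trans := by
    rintro x y z ⟨f, hf⟩ ⟨g, hg⟩
    exact ⟨f ≫ g, W.comp_mem hf hg⟩

theorem morRel_equiv (W : WideSubgroupoid C) : Equivalence W.MorRel where
  refl m := ⟨𝟙 _, 𝟙 _, W.id_mem _, W.id_mem _, by simp⟩
  symm := by
    rintro m m' ⟨v, w, hv, hw, h⟩
    have := W.is_iso hv
    have := W.is_iso hw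
    refine ⟨inv v, inv w, W.inv_mem hv (IsIso.hom_inv_id v),
      W.inv_mem hw (IsIso.hom_inv_id w), ?_⟩
    rw [IsIso.comp_inv_eq, Category.assoc, h, IsIso.inv_hom_id_assoc]
  trans := by
    rintro m m' m'' ⟨v, w, hv, hw, h⟩ ⟨v', w', hv', hw', h'⟩
    refine ⟨v ≫ v', w ≫ w', W.comp_mem hv hv', W.comp_mem hw hw', ?_⟩
    rw [← Category.assoc, h, Category.assoc, h', Category.assoc]

theorem mk_eq_iff (W : WideSubgroupoid C) (x y : C) :
    Quot.mk W.ObjRel x = Quot.mk W.ObjRel y ↔ W.ObjRel x y :=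
  ⟨fun h => W.objRel_equiv.eqvGen_iff.1 (Quot.eqvGen_exact h), fun h => Quot.sound h⟩

/-- the category structure on classes, computed on chosen representatives -/
noncomputable abbrev quotCat (W : WideSubgroupoid C) :
    Category.{max u v} (Quot W.ObjRel) where
  Hom X Y := ULift.{max u v} (X.out ⟶ Y.out)
  id X := ⟨𝟙 _⟩
  comp f g := ⟨f.down ≫ g.down⟩

theorem exists_conn (W : WideSubgroupoid C) (x : C) :
    W.ObjRel (Quot.mk W.ObjRel x).out x :=
  (W.mk_eq_iff _ _).1 (Quot.out_eq _)

/-- the comparison morphism from the chosen representative -/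
noncomputable def conn (W : WideSubgroupoid C) (x : C) : (Quot.mk W.ObjRel x).out ⟶ x :=
  (W.exists_conn x).choose

theorem conn_mem (W : WideSubgroupoid C) (x : C) : W.mem (W.conn x) :=
  (W.exists_conn x).choose_spec

noncomputable instance conn_iso (W : WideSubgroupoid C) (x : C) : IsIso (W.conn x) :=
  W.is_iso (W.conn_mem x)

theorem inv_conn_mem (W : WideSubgroupoid C) (x : C) : W.mem (inv (W.conn x)) :=
  W.inv_mem (W.conn_mem x) (IsIso.hom_inv_id _)

attribute [local instance] quotCat

/-- the canonical functor -/
noncomputable def proj (W : WideSubgroupoid C) : C ⥤ Quot W.ObjRel where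
  obj x := Quot.mk _ x
  map {x y} f := ⟨W.conn x ≫ f ≫ inv (W.conn y)⟩
  map_id x := by
    apply ULift.ext
    change _ = 𝟙 _
    simp
  map_comp f g := by
    apply ULift.ext
    change _ = (_ ≫ _ ≫ _) ≫ (_ ≫ _ ≫ _)
    simp

theorem eqToHom_mem (W : WideSubgroupoid C) {X Y : Quot W.ObjRel} (h : X = Y) :
    W.mem (eqToHom h).down := by
  subst h
  exact W.id_mem _

theorem proj_map_mem (W : WideSubgroupoid C) (hW : W.Rigid) {x y : C} {f : x ⟶ y}
    (hf : W.mem f) (h : W.proj.obj x = W.proj.obj y) : W.proj.map f = eqToHom h := by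
  apply ULift.ext
  exact hW (W.comp_mem (W.conn_mem x) (W.comp_mem hf (W.inv_conn_mem y))) (W.eqToHom_mem h)

theorem proj_full (W : WideSubgroupoid C) {x y : C} (g : W.proj.obj x ⟶ W.proj.obj y) :
    ∃ f : x ⟶ y, W.proj.map f = g := by
  refine ⟨inv (W.conn x) ≫ g.down ≫ W.conn y, ?_⟩
  apply ULift.ext
  have key : ∀ k : (Quot.mk W.ObjRel x).out ⟶ (Quot.mk W.ObjRel y).out,
      W.conn x ≫ (inv (W.conn x) ≫ k ≫ W.conn y) ≫ inv (W.conn y) = k := by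
    intro k
    simp
  exact key g.down

theorem proj_faithful (W : WideSubgroupoid C) {x y : C} {f g : x ⟶ y}
    (h : W.proj.map f = W.proj.map g) : f = g := by
  have h' : W.conn x ≫ f ≫ inv (W.conn y) = W.conn x ≫ g ≫ inv (W.conn y) :=
    congrArg ULift.down h
  exact (cancel_mono (inv (W.conn y))).1 ((cancel_epi (W.conn x)).1 h')

/-- the factorization -/
noncomputable def lift (W : WideSubgroupoid C) {D : Type u'} [Category.{v'} D] (F : C ⥤ D) :
    Quot W.ObjRel ⥤ D where
  obj X := F.obj X.out
  map g := F.map g.down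
  map_id X := F.map_id _
  map_comp f g := F.map_comp _ _

theorem proj_lift (W : WideSubgroupoid C) {D : Type u'} [Category.{v'} D] (F : C ⥤ D)
    (hF : W.IsStrict F) : W.proj ⋙ W.lift F = F := by
  refine CategoryTheory.Functor.ext (fun x => (hF (W.conn_mem x)).1) ?_
  intro x y f
  obtain ⟨h1, e1⟩ := hF (W.conn_mem x)
  obtain ⟨h2, e2⟩ := hF (W.inv_conn_mem y)
  have key : F.map (W.conn x ≫ f ≫ inv (W.conn y)) = eqToHom h1 ≫ F.map f ≫ eqToHom h2 := by
    rw [F.map_comp, F.map_comp, e1, e2]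
  exact key

theorem proj_epi (W : WideSubgroupoid C) {D : Type u'} [Category.{v'} D]
    (G H : Quot W.ObjRel ⥤ D) (h : W.proj ⋙ G = W.proj ⋙ H) : G = H := by
  refine CategoryTheory.Functor.ext (fun X => ?_) ?_
  · induction X using Quot.ind with
    | mk x => exact Functor.congr_obj h x
  · intro X Y g
    induction X using Quot.ind with
    | mk x =>
      induction Y using Quot.ind with
      | mk y =>
        obtain ⟨f, rfl⟩ := W.proj_full (x := x) (y := y) g
        exact Functor.congr_hom h f

end WideSubgroupoid

/-- For a rigid wide subgroupoid `W` of a category `C`: the relations `∼_W` on objects and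
on morphisms are equivalence relations, and the explicit quotient category `C/∼_W` (with
objects the classes of objects, morphisms the classes of morphisms, composition
`[g] ∘ [f] = [f ≫ w_{y,y'} ≫ g]` and identities `[𝟙 x]`) is well defined; its canonical
functor is `W`-strict and every `W`-strict functor out of `C` factors uniquely through it. -/
theorem WideSubgroupoid.explicitQuotient_of_rigid (W : WideSubgroupoid C) (hW : W.Rigid) :
    Equivalence W.ObjRel ∧ Equivalence W.MorRel ∧ Nonempty W.ExplicitQuotient := by
  refine ⟨W.objRel_equiv, W.morRel_equiv, ⟨?_⟩⟩
  letI := W.quotCat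
  refine
    { instCat := W.quotCat
      π := W.proj
      obj_eq := fun x => rfl
      obj_eq_iff := W.mk_eq_iff
      full := fun x y g => W.proj_full g
      hom_eq_iff := ?_
      comp_eq := ?_
      strict := ?_
      universal := ?_ }
  · intro x y x' y' f f' hx hy
    constructor
    · intro h
      obtain ⟨v, hv⟩ := (W.mk_eq_iff _ _).1 hx
      obtain ⟨w, hw⟩ := (W.mk_eq_iff _ _).1 hy
      refine ⟨v, w, hv, hw, ?_⟩
      apply W.proj_faithful
      rw [Functor.map_comp, Functor.map_comp, W.proj_map_mem hW hv hx,
        W.proj_map_mem hW hw hy]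
      exact h
    · rintro ⟨v, w, hv, hw, h⟩
      rw [← W.proj_map_mem hW hv hx, ← W.proj_map_mem hW hw hy, ← Functor.map_comp,
        ← Functor.map_comp]
      exact congrArg _ h
  · intro x y y' z f w g hw h
    rw [Functor.map_comp, Functor.map_comp, W.proj_map_mem hW hw h]
  · intro x y f hf
    have h : W.proj.obj x = W.proj.obj y := Quot.sound ⟨f, hf⟩
    exact ⟨h, W.proj_map_mem hW hf h⟩
  · intro D _ F hF
    refine ⟨W.lift F, W.proj_lift F hF, ?_⟩
    intro G hG
    exact W.proj_epi _ _ (hG.trans (W.proj_lift F hF).symm)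
end

section
/- (Coherent Newman's lemma) Let G be a groupoid and S a family of steps on G. If G is S-terminating and locally S-confluent, then G is S-confluent: for any two S-paths p₁ : x ⟶ y₁ and p₂ : x ⟶ y₂ there exist an object z and S-paths q₁ : y₁ ⟶ z and q₂ : y₂ ⟶ z such that p₁ ≫ q₁ = p₂ ≫ q₂ in G. -/
open CategoryTheory

universe v u

variable {G : Type u} [Groupoid.{v} G]

/-- `S`-paths: the smallest family of morphisms of `G` containing the steps of `S` and all
identities and closed under composition. -/
inductive IsPath (S : ∀ ⦃x y : G⦄, (x ⟶ y) → Prop) : ∀ ⦃x y : G⦄, (x ⟶ y) → Prop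
  | of {x y : G} {f : x ⟶ y} : S f → IsPath S f
  | id (x : G) : IsPath S (𝟙 x)
  | comp {x y z : G} {f : x ⟶ y} {g : y ⟶ z} : IsPath S f → IsPath S g → IsPath S (f ≫ g)

/-- `S`-zigzags: the smallest family of morphisms of `G` containing the steps of `S` and all
identities and closed under composition and inverses (the wide subgroupoid generated
by `S`). -/
inductive IsZigzag (S : ∀ ⦃x y : G⦄, (x ⟶ y) → Prop) : ∀ ⦃x y : G⦄, (x ⟶ y) → Prop
  | of {x y : G} {f : x ⟶ y} : S f → IsZigzag S f
  | id (x : G) : IsZigzag S (𝟙 x)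
  | comp {x y z : G} {f : x ⟶ y} {g : y ⟶ z} : IsZigzag S f → IsZigzag S g → IsZigzag S (f ≫ g)
  | inv {x y : G} {f : x ⟶ y} : IsZigzag S f → IsZigzag S (Groupoid.inv f)

/-- `G` is `S`-terminating: the relation relating `y` to `x` whenever there is a step
`x ⟶ y` is well-founded (no infinite sequence of steps). -/
def Terminating (S : ∀ ⦃x y : G⦄, (x ⟶ y) → Prop) : Prop :=
  WellFounded (fun y x : G => ∃ f : x ⟶ y, S f)

/-- `G` is locally `S`-confluent: any two steps with the same source can be closed by a
pair of cofinal `S`-paths making the square commute in `G`. -/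
def LocallyConfluent (S : ∀ ⦃x y : G⦄, (x ⟶ y) → Prop) : Prop :=
  ∀ ⦃x y₁ y₂ : G⦄ (a : x ⟶ y₁) (b : x ⟶ y₂), S a → S b →
    ∃ (z : G) (q₁ : y₁ ⟶ z) (q₂ : y₂ ⟶ z), IsPath S q₁ ∧ IsPath S q₂ ∧ a ≫ q₁ = b ≫ q₂

/-- `G` is `S`-confluent: any two `S`-paths with the same source can be closed by a pair of
cofinal `S`-paths making the square commute in `G`. -/
def Confluent (S : ∀ ⦃x y : G⦄, (x ⟶ y) → Prop) : Prop :=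
  ∀ ⦃x y₁ y₂ : G⦄ (p₁ : x ⟶ y₁) (p₂ : x ⟶ y₂), IsPath S p₁ → IsPath S p₂ →
    ∃ (z : G) (q₁ : y₁ ⟶ z) (q₂ : y₂ ⟶ z), IsPath S q₁ ∧ IsPath S q₂ ∧ p₁ ≫ q₁ = p₂ ≫ q₂

/-- An object is `S`-normal when no step has it as source. -/
def SNormal (S : ∀ ⦃x y : G⦄, (x ⟶ y) → Prop) (x : G) : Prop :=
  ∀ ⦃y : G⦄ (f : x ⟶ y), ¬ S f

/-- `G` is weakly `S`-normalizing: every object admits an `S`-path to an `S`-normal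
object. -/
def WeaklyNormalizing (S : ∀ ⦃x y : G⦄, (x ⟶ y) → Prop) : Prop :=
  ∀ x : G, ∃ (y : G) (p : x ⟶ y), IsPath S p ∧ SNormal S y

theorem IsPath.head_cases {S : ∀ ⦃x y : G⦄, (x ⟶ y) → Prop} {x y : G} {p : x ⟶ y}
    (hp : IsPath S p) : (∃ h : x = y, p = eqToHom h) ∨
      ∃ (w : G) (a : x ⟶ w) (q : w ⟶ y), S a ∧ IsPath S q ∧ p = a ≫ q := by
  induction hp with
  | of h => exact Or.inr ⟨_, _, 𝟙 _, h, IsPath.id _, by simp⟩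
  | id x => exact Or.inl ⟨rfl, by simp⟩
  | comp hf hg ihf ihg =>
    rcases ihf with ⟨h, rfl⟩ | ⟨w, a, q, ha, hq, rfl⟩
    · subst h
      simpa using ihg
    · exact Or.inr ⟨w, a, _, ha, IsPath.comp hq hg, by simp⟩

/-- Coherent Newman's lemma: a terminating and locally confluent system of steps on a
groupoid is confluent, with confluence diagrams commuting in the groupoid. -/
theorem confluent_of_terminating_of_locallyConfluent (S : ∀ ⦃x y : G⦄, (x ⟶ y) → Prop)
    (hterm : Terminating S) (hlc : LocallyConfluent S) : Confluent S := by
  intro x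
  induction x using hterm.induction with
  | _ x ih =>
  intro y₁ y₂ p₁ p₂ h₁ h₂
  rcases h₁.head_cases with ⟨h, rfl⟩ | ⟨w₁, a, r₁, ha, hr₁, rfl⟩
  · subst h
    exact ⟨y₂, p₂, 𝟙 _, h₂, IsPath.id _, by simp⟩
  rcases h₂.head_cases with ⟨h, rfl⟩ | ⟨w₂, b, r₂, hb, hr₂, rfl⟩
  · subst h
    exact ⟨y₁, 𝟙 _, _, IsPath.id _, h₁, by simp⟩
  obtain ⟨z, c₁, c₂, hc₁, hc₂, e⟩ := hlc a b ha hb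
  obtain ⟨u, d₁, d₂, hd₁, hd₂, e₁⟩ := ih w₁ ⟨a, ha⟩ r₁ c₁ hr₁ hc₁
  obtain ⟨t, f₁, f₂, hf₁, hf₂, e₂⟩ := ih w₂ ⟨b, hb⟩ (c₂ ≫ d₂) r₂ (hc₂.comp hd₂) hr₂
  refine ⟨t, d₁ ≫ f₁, f₂, hd₁.comp hf₁, hf₂, ?_⟩
  calc (a ≫ r₁) ≫ d₁ ≫ f₁ = a ≫ (r₁ ≫ d₁) ≫ f₁ := by simp
    _ = (a ≫ c₁) ≫ d₂ ≫ f₁ := by rw [e₁]; simp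
    _ = b ≫ (c₂ ≫ d₂) ≫ f₁ := by rw [e]; simp
    _ = (b ≫ r₂) ≫ f₂ := by rw [e₂]; simp
end

section
/- (Coherent Church–Rosser property) Let G be a groupoid and S a family of steps on G. Suppose G is weakly S-normalizing and S-confluent. Then for every S-zigzag f : x ⟶ y, every pair of S-normal objects x̂, ŷ and every pair of S-paths n_x : x ⟶ x̂ and n_y : y ⟶ ŷ, one has x̂ = ŷ and, modulo this equality of objects (composing with the corresponding eqToHom), f ≫ n_y = n_x in G. -/
open CategoryTheory

universe v u

variable {G : Type u} [Groupoid.{v} G]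

theorem IsPath.eq_of_normal (S : ∀ ⦃x y : G⦄, (x ⟶ y) → Prop) ⦃x y : G⦄ (f : x ⟶ y)
    (hf : IsPath S f) : SNormal S x → ∃ h : x = y, f = eqToHom h := by
  induction hf with
  | of h => intro hn; exact absurd h (hn _)
  | id x => intro _; exact ⟨rfl, rfl⟩
  | comp _ _ ih1 ih2 =>
    intro hn
    obtain ⟨h1, e1⟩ := ih1 hn
    subst h1
    obtain ⟨h2, e2⟩ := ih2 hn
    subst h2
    exact ⟨rfl, by simp [e1, e2]⟩

theorem norm_unique (S : ∀ ⦃x y : G⦄, (x ⟶ y) → Prop) (hc : Confluent S)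
    ⦃x x' y' : G⦄ (nx : x ⟶ x') (ny : x ⟶ y') (hnx : IsPath S nx) (hny : IsPath S ny)
    (hx' : SNormal S x') (hy' : SNormal S y') :
    ∃ h : x' = y', ny = nx ≫ eqToHom h := by
  obtain ⟨z, q1, q2, h1, h2, e⟩ := hc nx ny hnx hny
  obtain ⟨a, ea⟩ := IsPath.eq_of_normal S q1 h1 hx'
  obtain ⟨b, eb⟩ := IsPath.eq_of_normal S q2 h2 hy'
  subst a
  subst b
  refine ⟨rfl, ?_⟩
  simpa [ea, eb] using e.symm

/-- Coherent Church–Rosser property: if `G` is weakly `S`-normalizing and `S`-confluent,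
then for every `S`-zigzag `f : x ⟶ y` and every pair of normalization `S`-paths
`n_x : x ⟶ x̂`, `n_y : y ⟶ ŷ` to `S`-normal objects, one has `x̂ = ŷ` and, modulo this
equality of objects, `f ≫ n_y = n_x` in `G`. -/
theorem church_rosser (S : ∀ ⦃x y : G⦄, (x ⟶ y) → Prop)
    (hwn : WeaklyNormalizing S) (hc : Confluent S)
    ⦃x y : G⦄ (f : x ⟶ y) (hf : IsZigzag S f)
    (x' y' : G) (nx : x ⟶ x') (ny : y ⟶ y')
    (hnx : IsPath S nx) (hny : IsPath S ny)
    (hx' : SNormal S x') (hy' : SNormal S y') :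
    ∃ h : x' = y', f ≫ ny = nx ≫ eqToHom h := by
  induction hf generalizing x' y' with
  | of h => exact norm_unique S hc nx _ hnx (.comp (.of h) hny) hx' hy'
  | id x => 
    rw [Category.id_comp]
    exact norm_unique S hc nx ny hnx hny hx' hy'
  | comp _ _ ih1 ih2 =>
    rename_i b _ _ _ _ _
    obtain ⟨w, nw, hnw, hw⟩ := hwn b
    obtain ⟨h1, e1⟩ := ih1 x' w nx nw hnx hnw hx' hw
    obtain ⟨h2, e2⟩ := ih2 w y' nw ny hnw hny hw hy'
    subst h1
    subst h2
    refine ⟨rfl, ?_⟩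
    rw [Category.assoc, e2, ← Category.assoc, e1]
    simp
  | inv _ ih =>
    obtain ⟨h, e⟩ := ih y' x' ny nx hny hnx hy' hx'
    subst h
    refine ⟨rfl, ?_⟩
    simp only [eqToHom_refl, Category.comp_id] at e ⊢
    rw [← e, ← Category.assoc, Groupoid.inv_comp, Category.id_comp]
end

section
/- (Abstract coherence theorem) Let G be a groupoid and S a family of steps on G. If G is weakly S-normalizing and S-confluent, then G is S-coherent: any two parallel S-zigzags are equal, i.e. for all objects x, y and all morphisms f, g : x ⟶ y each belonging to the wide subgroupoid generated by S, one has f = g. -/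
open CategoryTheory

universe v u

variable {G : Type u} [Groupoid.{v} G]

theorem path_from_normal_aux {S : ∀ ⦃x y : G⦄, (x ⟶ y) → Prop} {x y : G} {f : x ⟶ y}
    (hf : IsPath S f) : SNormal S x → ∃ e : x = y, f = eqToHom e := by
  induction hf with
  | of h => exact fun hx => absurd h (hx _)
  | id x => exact fun _ => ⟨rfl, rfl⟩
  | comp _ _ ih1 ih2 =>
    intro hx
    obtain ⟨rfl, h1⟩ := ih1 hx
    obtain ⟨rfl, h2⟩ := ih2 hx
    exact ⟨rfl, by simp [h1, h2]⟩

theorem normal_unique_aux {S : ∀ ⦃x y : G⦄, (x ⟶ y) → Prop} (hc : Confluent S) {x n m : G}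
    {p : x ⟶ n} {q : x ⟶ m} (hp : IsPath S p) (hq : IsPath S q) (hn : SNormal S n)
    (hm : SNormal S m) : ∃ e : n = m, p ≫ eqToHom e = q := by
  obtain ⟨z, a, b, ha, hb, h⟩ := hc p q hp hq
  obtain ⟨rfl, h1⟩ := path_from_normal_aux ha hn
  obtain ⟨rfl, h2⟩ := path_from_normal_aux hb hm
  exact ⟨rfl, by simpa [h1, h2] using h⟩

theorem zigzag_aux {S : ∀ ⦃x y : G⦄, (x ⟶ y) → Prop} (hwn : WeaklyNormalizing S)
    (hc : Confluent S) {x y : G} {f : x ⟶ y} (hf : IsZigzag S f) :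
    ∀ {n m : G} (p : x ⟶ n) (q : y ⟶ m), IsPath S p → IsPath S q → SNormal S n → SNormal S m →
      ∃ e : n = m, p ≫ eqToHom e = f ≫ q := by
  induction hf with
  | of h =>
    intro n m p q hp hq hn hm
    exact normal_unique_aux hc hp (.comp (.of h) hq) hn hm
  | id x =>
    intro n m p q hp hq hn hm
    exact normal_unique_aux hc hp (.comp (.id x) hq) hn hm
  | @comp x y z f g _ _ ih1 ih2 =>
    intro n m p q hp hq hn hm
    obtain ⟨k, r, hr, hk⟩ := hwn y
    obtain ⟨rfl, h1⟩ := ih1 p r hp hr hn hk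
    obtain ⟨rfl, h2⟩ := ih2 r q hr hq hk hm
    refine ⟨rfl, ?_⟩
    rw [Category.assoc, ← h2, h1.trans (by simp : f ≫ r = f ≫ r ≫ eqToHom rfl)]
  | inv _ ih =>
    intro n m p q hp hq hn hm
    obtain ⟨rfl, h1⟩ := ih q p hq hp hm hn
    refine ⟨rfl, ?_⟩
    simp only [eqToHom_refl, Category.comp_id] at h1 ⊢
    rw [h1, ← Category.assoc, Groupoid.inv_comp, Category.id_comp]

/-- Abstract coherence theorem: if `G` is weakly `S`-normalizing and `S`-confluent, then it
is `S`-coherent: any two parallel `S`-zigzags (morphisms of the wide subgroupoid generated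
by `S`) are equal. -/
theorem coherent_of_weaklyNormalizing_of_confluent (S : ∀ ⦃x y : G⦄, (x ⟶ y) → Prop)
    (hwn : WeaklyNormalizing S) (hc : Confluent S) :
    ∀ ⦃x y : G⦄ (f g : x ⟶ y), IsZigzag S f → IsZigzag S g → f = g := by
  intro x y f g hf hg
  obtain ⟨n, p, hp, hn⟩ := hwn x
  obtain ⟨m, q, hq, hm⟩ := hwn y
  obtain ⟨_, h1⟩ := zigzag_aux hwn hc hf p q hp hq hn hm
  obtain ⟨_, h2⟩ := zigzag_aux hwn hc hg p q hp hq hn hm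
  exact (cancel_mono q).1 (h1.symm.trans h2)
end
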